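/- Let ℓ ∈ ℕ, let B₀ be a finite set with |B₀| = n ≥ 1, and let 𝒞 be a nonempty family of colorings c : B₀ → {1,2,3,4} such that for all pairwise disjoint B₁, B₂, B₃, B₄ ⊆ B₀ with |B₁ ∪ B₂ ∪ B₃ ∪ B₄| ≤ 10ℓ there is a c ∈ 𝒞 with c(x) = i for every x ∈ Bᵢ and every i ∈ {1,2,3,4}. Then every family F of subsets of B₀ admits an ℓ-diverse representative F̂ ⊆ F of size at most 2 + 3·|𝒞|·(n+1)⁴. -/

import Mathlib

/-- `Fhat` is an `ℓ`-diverse representative of the family `F` of finite sets. -/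
def IsDiverseRep {α : Type*} [DecidableEq α] (ℓ : ℕ) (F Fhat : Set (Finset α)) : Prop :=
  Fhat ⊆ F ∧ ∀ S ∈ F, ∀ A B : Finset α,
    ℓ ≤ (symmDiff A S).card → ℓ ≤ (symmDiff B S).card →
    ∃ Shat ∈ Fhat, ℓ ≤ (symmDiff A Shat).card ∧ ℓ ≤ (symmDiff B Shat).card

section Representatives

variable {α : Type*} [DecidableEq α]

/-- Translating both arguments by `Q` does not change a symmetric difference. -/
theorem symmDiff_translate (A S Q : Finset α) :
    symmDiff (symmDiff A Q) (symmDiff S Q) = symmDiff A S := by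
  rw [symmDiff_comm S Q, symmDiff_assoc, symmDiff_symmDiff_cancel_left]

theorem card_symmDiff_add_two_mul_card_inter (A B : Finset α) :
    (symmDiff A B).card + 2 * (A ∩ B).card = A.card + B.card := by
  have h : (symmDiff A B).card = (A \ B).card + (B \ A).card :=
    Finset.card_union_of_disjoint disjoint_sdiff_sdiff
  have hA := Finset.card_sdiff_add_card_inter A B
  have hB := Finset.card_sdiff_add_card_inter B A
  rw [Finset.inter_comm B A] at hB
  omega

theorem card_symmDiff_triangle (A B C : Finset α) :
    (symmDiff A C).card ≤ (symmDiff A B).card + (symmDiff B C).card :=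
  (Finset.card_le_card (symmDiff_triangle A B C)).trans (Finset.card_union_le _ _)

/-- If `p` agrees with membership in `X` on `S` and holds on `X ∩ T`, and `S`, `T` have equally
many elements satisfying and violating `p`, then `T` is at least as far from `X` as `S` is. -/
theorem card_symmDiff_le_of_card_filter_eq {X S T : Finset α} {p : α → Prop} [DecidablePred p]
    (hp : (T.filter p).card = (S.filter p).card) (hc : T.card = S.card)
    (hS : ∀ x ∈ S, p x → x ∈ X) (hT : ∀ x ∈ T, x ∈ X → p x) :
    (symmDiff X S).card ≤ (symmDiff X T).card := by
  have h₁ : (S.filter p).card ≤ (X ∩ S).card := Finset.card_le_card fun x hx => by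
    simp only [Finset.mem_filter, Finset.mem_inter] at *
    exact ⟨hS x hx.1 hx.2, hx.1⟩
  have h₂ : (X ∩ T).card ≤ (T.filter p).card := Finset.card_le_card fun x hx => by
    simp only [Finset.mem_filter, Finset.mem_inter] at *
    exact ⟨hx.2, hT x hx.2 hx.1⟩
  have h₃ := card_symmDiff_add_two_mul_card_inter X S
  have h₄ := card_symmDiff_add_two_mul_card_inter X T
  omega

/-- The number of elements of `S` with color in `P` is determined by the numbers for single
colors. -/
theorem card_filter_color_mem {α : Type*} (c : α → Fin 4) (S : Finset α) (P : Finset (Fin 4)) :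
    (S.filter (c · ∈ P)).card = ∑ i ∈ P, (S.filter (c · = i)).card := by
  rw [Finset.card_eq_sum_card_fiberwise (f := c) (t := P) fun x hx => by simp_all]
  refine Finset.sum_congr rfl fun i hi => ?_
  rw [Finset.filter_filter]
  exact congrArg _ (Finset.filter_congr fun x _ => and_iff_right_of_imp fun h => h ▸ hi)

theorem exists_fiber_representatives {β κ : Type*} [DecidableEq β] [Fintype κ] [DecidableEq κ]
    (G : Finset β) (f : β → κ) :
    ∃ H ⊆ G, H.card ≤ Fintype.card κ ∧ ∀ g ∈ G, ∃ h ∈ H, f h = f g := by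
  have h : ∀ k ∈ G.image f, ∃ g ∈ G, f g = k := fun k hk => by simpa using hk
  choose r hr hfr using h
  refine ⟨(G.image f).attach.image fun k : {k // k ∈ G.image f} => r k k.2, ?_,
    Finset.card_image_le.trans (Finset.card_attach.trans_le (Finset.card_le_univ _)), ?_⟩
  · intro x hx
    obtain ⟨k, -, rfl⟩ := Finset.mem_image.1 hx
    exact hr k k.2
  · intro g hg
    have hk := Finset.mem_image_of_mem f hg
    exact ⟨r (f g) hk, Finset.mem_image.2 ⟨⟨_, hk⟩, Finset.mem_attach _ _, rfl⟩, hfr _ hk⟩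

/-- A family of colorings realizing all small disjoint quadruples realizes every coloring of every
small subset. -/
theorem exists_coloring_eq_on {ℓ : ℕ} {B₀ : Finset α} {𝒞 : Finset (α → Fin 4)}
    (h𝒞 : ∀ B : Fin 4 → Finset α,
      (∀ i, B i ⊆ B₀) →
      (∀ i j, i ≠ j → Disjoint (B i) (B j)) →
      (B 0 ∪ B 1 ∪ B 2 ∪ B 3).card ≤ 10 * ℓ →
      ∃ c ∈ 𝒞, ∀ i, ∀ x ∈ B i, c x = i)
    {W : Finset α} (hW : W ⊆ B₀) (hcard : W.card ≤ 10 * ℓ) (g : α → Fin 4) :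
    ∃ c ∈ 𝒞, ∀ x ∈ W, c x = g x := by
  obtain ⟨c, hc, h⟩ := h𝒞 (fun i => W.filter (g · = i))
    (fun i => (Finset.filter_subset _ _).trans hW)
    (fun i j hij => Finset.disjoint_filter.2 fun x _ hi hj => hij (hi.symm.trans hj))
    ((Finset.card_le_card (by
      simp only [Finset.union_subset_iff, Finset.filter_subset, and_self])).trans hcard)
  exact ⟨c, hc, fun x hx => h (g x) x (by simp [hx])⟩

/-- The part of a family lying within distance `2ℓ` of a fixed set `Q` has a representative with
one set for each coloring and each vector of color counts relative to `Q`. -/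
theorem exists_representative_near {ℓ n : ℕ} {B₀ : Finset α} (hn : B₀.card = n)
    {𝒞 : Finset (α → Fin 4)}
    (h𝒞 : ∀ B : Fin 4 → Finset α,
      (∀ i, B i ⊆ B₀) →
      (∀ i j, i ≠ j → Disjoint (B i) (B j)) →
      (B 0 ∪ B 1 ∪ B 2 ∪ B 3).card ≤ 10 * ℓ →
      ∃ c ∈ 𝒞, ∀ i, ∀ x ∈ B i, c x = i)
    {F : Set (Finset α)} (hFB : ∀ S ∈ F, S ⊆ B₀) {Q : Finset α} (hQ : Q ⊆ B₀) :
    ∃ Fhat : Finset (Finset α), (Fhat : Set (Finset α)) ⊆ F ∧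
      Fhat.card ≤ 𝒞.card * (n + 1) ^ 4 ∧
      IsDiverseRep ℓ {S ∈ F | (symmDiff S Q).card ≤ 2 * ℓ} Fhat := by
  classical
  set G := B₀.powerset.filter fun S => S ∈ F ∧ (symmDiff S Q).card ≤ 2 * ℓ with hG
  have mem_G : ∀ {S}, S ∈ G ↔ S ∈ F ∧ (symmDiff S Q).card ≤ 2 * ℓ := fun {S} => by
    simp only [hG, Finset.mem_filter, Finset.mem_powerset, and_iff_right_iff_imp]
    exact fun h => hFB S h.1
  have sub_B₀ : ∀ {S}, S ∈ F → symmDiff S Q ⊆ B₀ := fun {S} hS =>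
    symmDiff_le_sup.trans (Finset.union_subset (hFB S hS) hQ)
  choose H hHG hHcard hH using fun c : α → Fin 4 =>
    exists_fiber_representatives G fun S (i : Fin 4) =>
      Fin.ofNat (n + 1) ((symmDiff S Q).filter (c · = i)).card
  have hHat : ∀ {S}, S ∈ 𝒞.biUnion H → S ∈ G := fun {S} hS => by
    obtain ⟨c, -, hc⟩ := Finset.mem_biUnion.1 hS
    exact hHG c hc
  refine ⟨𝒞.biUnion H, fun S hS => (mem_G.1 (hHat hS)).1, ?_, fun S hS => mem_G.1 (hHat hS), ?_⟩
  · refine Finset.card_biUnion_le_card_mul _ _ _ fun c _ => (hHcard c).trans ?_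
    simp
  rintro S ⟨hSF, hSQ⟩ A B hA hB
  rw [← symmDiff_translate A S Q] at hA
  rw [← symmDiff_translate B S Q] at hB
  set S' := symmDiff S Q
  set X := if (symmDiff A Q).card < 3 * ℓ then symmDiff A Q else ∅ with hX
  set Y := if (symmDiff B Q).card < 3 * ℓ then symmDiff B Q else ∅ with hY
  have hXcard : X.card ≤ 3 * ℓ := by rw [hX]; split_ifs <;> [omega; simp]
  have hYcard : Y.card ≤ 3 * ℓ := by rw [hY]; split_ifs <;> [omega; simp]
  obtain ⟨c, hc𝒞, hc⟩ := exists_coloring_eq_on h𝒞 (W := S' ∪ (X ∪ Y) ∩ B₀)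
    (Finset.union_subset (sub_B₀ hSF) Finset.inter_subset_right)
    (by
      have h₁ := Finset.card_union_le S' ((X ∪ Y) ∩ B₀)
      have h₂ := Finset.card_le_card (Finset.inter_subset_left : (X ∪ Y) ∩ B₀ ⊆ X ∪ Y)
      have h₃ := Finset.card_union_le X Y
      omega)
    fun x => if x ∈ X then if x ∈ Y then 3 else 1 else if x ∈ Y then 2 else 0
  obtain ⟨T, hTH, hT⟩ := hH c S (mem_G.2 ⟨hSF, hSQ⟩)
  obtain ⟨hTF, hTQ⟩ := mem_G.1 (hHG c hTH)
  set T' := symmDiff T Q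
  have hcount : ∀ P : Finset (Fin 4),
      (T'.filter (c · ∈ P)).card = (S'.filter (c · ∈ P)).card := by
    intro P
    simp only [card_filter_color_mem]
    refine Finset.sum_congr rfl fun i _ => ?_
    have hi := congrArg Fin.val (congrFun hT i)
    have lt_succ : ∀ {R}, R ∈ F → ((symmDiff R Q).filter (c · = i)).card < n + 1 := fun {R} hR =>
      Nat.lt_succ_of_le (hn ▸ Finset.card_le_card ((Finset.filter_subset _ _).trans (sub_B₀ hR)))
    rwa [Fin.val_ofNat, Fin.val_ofNat, Nat.mod_eq_of_lt (lt_succ hTF),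
      Nat.mod_eq_of_lt (lt_succ hSF)] at hi
  have hcard : T'.card = S'.card := by simpa using hcount Finset.univ
  have far : ∀ {D Z : Finset α} {P : Finset (Fin 4)},
      Z = (if (symmDiff D Q).card < 3 * ℓ then symmDiff D Q else ∅) →
      (∀ x ∈ S' ∪ (X ∪ Y) ∩ B₀, c x ∈ P ↔ x ∈ Z) → Z ⊆ X ∪ Y →
      ℓ ≤ (symmDiff (symmDiff D Q) S').card → ℓ ≤ (symmDiff D T).card := by
    intro D Z P hZ hP hZXY hD
    rw [← symmDiff_translate D T Q]
    split_ifs at hZ with hDQ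
    · subst hZ
      refine hD.trans (card_symmDiff_le_of_card_filter_eq (hcount P) hcard ?_ ?_)
      · exact fun x hx => (hP x (Finset.mem_union_left _ hx)).1
      · exact fun x hx hxZ => (hP x (Finset.mem_union_right _
          (Finset.mem_inter.2 ⟨hZXY hxZ, sub_B₀ hTF hx⟩))).2 hxZ
    · have h₁ := card_symmDiff_add_two_mul_card_inter (symmDiff D Q) T'
      have h₂ := Finset.card_le_card (Finset.inter_subset_right : symmDiff D Q ∩ T' ⊆ T')
      change ℓ ≤ (symmDiff (symmDiff D Q) T').card
      omega
  refine ⟨T, Finset.mem_biUnion.2 ⟨c, hc𝒞, hTH⟩, ?_, ?_⟩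
  · refine far (P := {1, 3}) hX (fun x hx => ?_) Finset.subset_union_left hA
    rw [hc x hx]
    by_cases hxX : x ∈ X <;> by_cases hxY : x ∈ Y <;> simp only [hxX, hxY] <;> decide
  · refine far (P := {2, 3}) hY (fun x hx => ?_) Finset.subset_union_right hB
    rw [hc x hx]
    by_cases hxX : x ∈ X <;> by_cases hxY : x ∈ Y <;> simp only [hxX, hxY] <;> decide

/-- Three sets at pairwise distance at least `2ℓ` represent every family containing them. -/
theorem isDiverseRep_of_separated {ℓ : ℕ} {F : Set (Finset α)} {S₁ S₂ S₃ : Finset α}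
    (h₁ : S₁ ∈ F) (h₂ : S₂ ∈ F) (h₃ : S₃ ∈ F) (h₁₂ : 2 * ℓ ≤ (symmDiff S₁ S₂).card)
    (h₁₃ : 2 * ℓ ≤ (symmDiff S₁ S₃).card) (h₂₃ : 2 * ℓ ≤ (symmDiff S₂ S₃).card) :
    IsDiverseRep ℓ F ({S₁, S₂, S₃} : Set (Finset α)) := by
  refine ⟨by simp [Set.insert_subset_iff, h₁, h₂, h₃], fun S _ A B _ _ => ?_⟩
  have near : ∀ {D U V : Finset α}, 2 * ℓ ≤ (symmDiff U V).card →
      ℓ ≤ (symmDiff D U).card ∨ ℓ ≤ (symmDiff D V).card := fun {D U V} h => by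
    have := card_symmDiff_triangle U D V
    rw [symmDiff_comm U D] at this
    omega
  have hA₁₂ := near (D := A) h₁₂
  have hA₁₃ := near (D := A) h₁₃
  have hA₂₃ := near (D := A) h₂₃
  have hB₁₂ := near (D := B) h₁₂
  have hB₁₃ := near (D := B) h₁₃
  have hB₂₃ := near (D := B) h₂₃
  simp only [Set.mem_insert_iff, Set.mem_singleton_iff, exists_eq_or_imp, exists_eq_left]
  omega

/-- A nonempty family without three sets at pairwise distance at least `2ℓ` is covered by two balls
of radius `2ℓ` centered in the family. -/
theorem exists_two_centers {ℓ : ℕ} {F : Set (Finset α)} (hF : F.Nonempty)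
    (h : ¬ ∃ S₁ ∈ F, ∃ S₂ ∈ F, ∃ S₃ ∈ F, 2 * ℓ ≤ (symmDiff S₁ S₂).card ∧
      2 * ℓ ≤ (symmDiff S₁ S₃).card ∧ 2 * ℓ ≤ (symmDiff S₂ S₃).card) :
    ∃ Q₁ ∈ F, ∃ Q₂ ∈ F, ∀ S ∈ F,
      (symmDiff S Q₁).card ≤ 2 * ℓ ∨ (symmDiff S Q₂).card ≤ 2 * ℓ := by
  by_cases h₂ : ∃ Q₁ ∈ F, ∃ Q₂ ∈ F, 2 * ℓ ≤ (symmDiff Q₁ Q₂).card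
  · obtain ⟨Q₁, hQ₁, Q₂, hQ₂, hQ⟩ := h₂
    refine ⟨Q₁, hQ₁, Q₂, hQ₂, fun S hS => ?_⟩
    by_contra! hcon
    exact h ⟨S, hS, Q₁, hQ₁, Q₂, hQ₂, hcon.1.le, hcon.2.le, hQ⟩
  · obtain ⟨Q, hQ⟩ := hF
    push Not at h₂
    exact ⟨Q, hQ, Q, hQ, fun S hS => .inl (h₂ S hS Q hQ).le⟩

end Representatives

/-- given a nonempty family `𝒞` of four-colorings of a finite set `B₀`
of size `n ≥ 1` covering all disjoint quadruples of total size at most `10ℓ`,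
every family `F` of subsets of `B₀` admits an `ℓ`-diverse representative of size
at most `2 + 3 · |𝒞| · (n + 1)⁴`. Colors `{1,2,3,4}` are modeled as `Fin 4`. -/
theorem small_diverse_representative_exists
    {α : Type*} [DecidableEq α] (ℓ n : ℕ) (B₀ : Finset α)
    (hn : B₀.card = n) (hn1 : 1 ≤ n)
    (𝒞 : Finset (α → Fin 4)) (h𝒞ne : 𝒞.Nonempty)
    (h𝒞 : ∀ B : Fin 4 → Finset α,
      (∀ i, B i ⊆ B₀) →
      (∀ i j, i ≠ j → Disjoint (B i) (B j)) →
      (B 0 ∪ B 1 ∪ B 2 ∪ B 3).card ≤ 10 * ℓ →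
      ∃ c ∈ 𝒞, ∀ i, ∀ x ∈ B i, c x = i)
    (F : Set (Finset α)) (hFB : ∀ S ∈ F, S ⊆ B₀) :
    ∃ Fhat : Finset (Finset α),
      IsDiverseRep ℓ F ↑Fhat ∧ Fhat.card ≤ 2 + 3 * 𝒞.card * (n + 1) ^ 4 := by
  rcases F.eq_empty_or_nonempty with rfl | hF
  · exact ⟨∅, ⟨by simp, by simp⟩, by simp⟩
  by_cases hsep : ∃ S₁ ∈ F, ∃ S₂ ∈ F, ∃ S₃ ∈ F, 2 * ℓ ≤ (symmDiff S₁ S₂).card ∧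
      2 * ℓ ≤ (symmDiff S₁ S₃).card ∧ 2 * ℓ ≤ (symmDiff S₂ S₃).card
  · obtain ⟨S₁, h₁, S₂, h₂, S₃, h₃, h₁₂, h₁₃, h₂₃⟩ := hsep
    refine ⟨{S₁, S₂, S₃}, ?_, Finset.card_le_three.trans ?_⟩
    · simpa using isDiverseRep_of_separated h₁ h₂ h₃ h₁₂ h₁₃ h₂₃
    · have : 0 < 3 * 𝒞.card * (n + 1) ^ 4 := by have := h𝒞ne.card_pos; positivity
      omega
  · obtain ⟨Q₁, hQ₁, Q₂, hQ₂, hQ⟩ := exists_two_centers hF hsep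
    obtain ⟨F₁, hF₁, hcard₁, hrep₁⟩ := exists_representative_near hn h𝒞 hFB (hFB Q₁ hQ₁)
    obtain ⟨F₂, hF₂, hcard₂, hrep₂⟩ := exists_representative_near hn h𝒞 hFB (hFB Q₂ hQ₂)
    refine ⟨F₁ ∪ F₂, ⟨by simp [hF₁, hF₂], fun S hS A B hA hB => ?_⟩, ?_⟩
    · rcases hQ S hS with h | h
      · obtain ⟨T, hT, hT'⟩ := hrep₁.2 S ⟨hS, h⟩ A B hA hB
        exact ⟨T, by simp [Finset.mem_coe.1 hT], hT'⟩
      · obtain ⟨T, hT, hT'⟩ := hrep₂.2 S ⟨hS, h⟩ A B hA hB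
        exact ⟨T, by simp [Finset.mem_coe.1 hT], hT'⟩
    · have := Finset.card_union_le F₁ F₂
      rw [mul_assoc]
      omega
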